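/- Let ε = ±1. Consider the Type B connection on the half-plane {x¹ > 0} with Christoffel symbols Γ_{11}^1 = −1/x¹, Γ_{12}^2 = Γ_{21}^2 = −1/x¹, Γ_{22}^1 = ε/x¹ and all other Γ_{ij}^k = 0 (for ε = 1 this is the Levi-Civita connection of the hyperbolic plane metric (x¹)^{-2}((dx¹)²+(dx²)²), for ε = −1 of its Lorentzian analogue; the symmetric Ricci tensor is ρ_s = (x¹)^{-2}(−dx¹⊗dx¹ − ε·dx²⊗dx²)). The set of smooth f on {x¹ > 0} satisfying (Hf)₁₁ = (x¹)^{-2}·f, (Hf)₁₂ = 0 and (Hf)₂₂ = ε(x¹)^{-2}·f (the affine quasi-Einstein equation with μ = −1) is exactly the real span of the three functions (x¹)^{-1}, x²/x¹, and ((x²)² + ε(x¹)²)/x¹. -/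

import Mathlib

/-- Partial derivative in the first coordinate direction. -/
noncomputable def pd1 (f : ℝ × ℝ → ℝ) : ℝ × ℝ → ℝ := fun p => fderiv ℝ f p (1, 0)

/-- Partial derivative in the second coordinate direction. -/
noncomputable def pd2 (f : ℝ × ℝ → ℝ) : ℝ × ℝ → ℝ := fun p => fderiv ℝ f p (0, 1)


def HG (g : ℝ × ℝ → ℝ) (a b : ℝ) (p : ℝ × ℝ) : Prop :=
  HasFDerivAt g (a • ContinuousLinearMap.fst ℝ ℝ ℝ + b • ContinuousLinearMap.snd ℝ ℝ ℝ) p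

theorem HG.of {g : ℝ × ℝ → ℝ} {p : ℝ × ℝ} (h : DifferentiableAt ℝ g p) :
    HG g (pd1 g p) (pd2 g p) p := by
  unfold HG
  refine h.hasFDerivAt.congr_fderiv ?_
  ext <;> simp [pd1, pd2]

theorem HG.pd1 {g : ℝ × ℝ → ℝ} {a b : ℝ} {p : ℝ × ℝ} (h : HG g a b p) : pd1 g p = a := by
  unfold HG at h
  simp [_root_.pd1, h.fderiv]

theorem HG.pd2 {g : ℝ × ℝ → ℝ} {a b : ℝ} {p : ℝ × ℝ} (h : HG g a b p) : pd2 g p = b := by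
  unfold HG at h
  simp [_root_.pd2, h.fderiv]

theorem HG.add {g k : ℝ × ℝ → ℝ} {a b c d : ℝ} {p : ℝ × ℝ} (h : HG g a b p) (h' : HG k c d p) :
    HG (fun q => g q + k q) (a + c) (b + d) p := by
  unfold HG at *
  refine (HasFDerivAt.add h h').congr_fderiv ?_
  ext <;> simp

theorem HG.sub {g k : ℝ × ℝ → ℝ} {a b c d : ℝ} {p : ℝ × ℝ} (h : HG g a b p) (h' : HG k c d p) :
    HG (fun q => g q - k q) (a - c) (b - d) p := by
  unfold HG at *
  refine (HasFDerivAt.sub h h').congr_fderiv ?_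
  ext <;> simp

theorem HG.mul {g k : ℝ × ℝ → ℝ} {a b c d : ℝ} {p : ℝ × ℝ} (h : HG g a b p) (h' : HG k c d p) :
    HG (fun q => g q * k q) (a * k p + g p * c) (b * k p + g p * d) p := by
  unfold HG at *
  refine (HasFDerivAt.mul h h').congr_fderiv ?_
  ext <;> simp <;> ring

theorem HG.const (c : ℝ) (p : ℝ × ℝ) : HG (fun _ => c) 0 0 p := by
  unfold HG
  simpa using hasFDerivAt_const c p

theorem HG.fst (p : ℝ × ℝ) : HG (fun q => q.1) 1 0 p := by
  unfold HG
  simpa using hasFDerivAt_fst (𝕜 := ℝ) (p := p)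

theorem HG.snd (p : ℝ × ℝ) : HG (fun q => q.2) 0 1 p := by
  unfold HG
  simpa using hasFDerivAt_snd (𝕜 := ℝ) (p := p)

theorem HG.inv (p : ℝ × ℝ) (hp : 0 < p.1) : HG (fun q => q.1⁻¹) (-(p.1 ^ 2)⁻¹) 0 p := by
  unfold HG
  have := (hasDerivAt_inv hp.ne').comp_hasFDerivAt p (hasFDerivAt_fst (𝕜 := ℝ) (p := p))
  refine this.congr_fderiv ?_
  ext <;> simp

theorem HG.congr {g : ℝ × ℝ → ℝ} {a b c d : ℝ} {p : ℝ × ℝ} (h : HG g a b p)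
    (h1 : a = c) (h2 : b = d) : HG g c d p := by
  subst h1 h2; exact h

theorem isOpen_half : IsOpen {p : ℝ × ℝ | 0 < p.1} := isOpen_lt continuous_const continuous_fst

theorem HG.congr_fun {g k : ℝ × ℝ → ℝ} {a b : ℝ} {p : ℝ × ℝ} (h : HG g a b p) (hp : 0 < p.1)
    (e : ∀ q : ℝ × ℝ, 0 < q.1 → k q = g q) : HG k a b p := by
  unfold HG at *
  refine h.congr_of_eventuallyEq ?_
  filter_upwards [isOpen_half.mem_nhds hp] with q hq using e q hq

theorem HG.is_const {g : ℝ × ℝ → ℝ} (h : ∀ p : ℝ × ℝ, 0 < p.1 → HG g 0 0 p) :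
    ∃ c, ∀ p : ℝ × ℝ, 0 < p.1 → g p = c := by
  have hc : Convex ℝ {p : ℝ × ℝ | 0 < p.1} :=
    (convex_Ioi (0 : ℝ)).is_linear_preimage (f := fun p : ℝ × ℝ => p.1) ⟨fun _ _ => rfl, fun _ _ => rfl⟩
  refine ⟨g (1, 0), fun p hp => ?_⟩
  refine isOpen_half.is_const_of_fderiv_eq_zero (𝕜 := ℝ) hc.isPreconnected
    (fun q hq => (h q hq).differentiableAt.differentiableWithinAt) ?_ hp (by simp)
  intro q hq
  have := (h q hq).fderiv
  simpa using this

/-- For the hyperbolic plane (ε = 1) or its Lorentzian analogue (ε = −1), i.e. the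
Type B connection Γ₁₁¹ = −1/x¹, Γ₁₂² = −1/x¹, Γ₂₂¹ = ε/x¹ on {x¹ > 0}, the smooth
solutions of the affine quasi-Einstein equation with μ = −1 are exactly the span of
(x¹)⁻¹, x²/x¹ and ((x²)² + ε(x¹)²)/x¹. -/
theorem stmt13 (ε : ℝ) (hε : ε = 1 ∨ ε = -1) (f : ℝ × ℝ → ℝ) :
    (ContDiffOn ℝ (⊤ : ℕ∞) f {p : ℝ × ℝ | 0 < p.1} ∧
      ∀ p : ℝ × ℝ, 0 < p.1 →
        pd1 (pd1 f) p - (-1 / p.1) * pd1 f p = (1 / p.1 ^ 2) * f p ∧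
        pd1 (pd2 f) p - (-1 / p.1) * pd2 f p = 0 ∧
        pd2 (pd2 f) p - (ε / p.1) * pd1 f p = (ε / p.1 ^ 2) * f p) ↔
    (∃ a b c : ℝ, ∀ p : ℝ × ℝ, 0 < p.1 →
      f p = a * p.1⁻¹ + b * (p.2 / p.1) + c * ((p.2 ^ 2 + ε * p.1 ^ 2) / p.1)) := by
  have he2 : ε * ε = 1 := by rcases hε with h | h <;> simp [h]
  constructor
  · rintro ⟨hf, H⟩
    have hfd : ContDiffOn ℝ (⊤ : ℕ∞) (fderiv ℝ f) {p : ℝ × ℝ | 0 < p.1} :=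
      hf.fderiv_of_isOpen isOpen_half (by simp)
    have dA : ∀ {F : Type} [NormedAddCommGroup F] [NormedSpace ℝ F] {g : ℝ × ℝ → F},
        ContDiffOn ℝ (⊤ : ℕ∞) g {p : ℝ × ℝ | 0 < p.1} → ∀ p : ℝ × ℝ, 0 < p.1 →
        DifferentiableAt ℝ g p := fun hg p hp =>
      (hg.contDiffAt (isOpen_half.mem_nhds hp)).differentiableAt (by simp)
    have h0 : ∀ p : ℝ × ℝ, 0 < p.1 → HG f (pd1 f p) (pd2 f p) p := fun p hp => .of (dA hf p hp)
    have h2 : ∀ p : ℝ × ℝ, 0 < p.1 → HG (pd2 f) (pd1 (pd2 f) p) (pd2 (pd2 f) p) p :=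
      fun p hp => .of ((dA hfd p hp).clm_apply (differentiableAt_const _))
    have hsym : ∀ p : ℝ × ℝ, 0 < p.1 → pd2 (pd1 f) p = pd1 (pd2 f) p := by
      intro p hp
      have hs : IsSymmSndFDerivAt ℝ f p :=
        (hf.contDiffAt (isOpen_half.mem_nhds hp)).isSymmSndFDerivAt (by
          simp only [minSmoothness_of_isRCLikeNormedField]
          exact WithTop.coe_le_coe.2 (le_top : (2 : ℕ∞) ≤ ⊤))
      have e := hs (0, 1) (1, 0)
      have hd := (dA hfd p hp).hasFDerivAt
      have e1 := (hd.clm_apply (hasFDerivAt_const ((1, 0) : ℝ × ℝ) p)).fderiv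
      have e2 := (hd.clm_apply (hasFDerivAt_const ((0, 1) : ℝ × ℝ) p)).fderiv
      have e3 : pd2 (pd1 f) p = fderiv ℝ (fderiv ℝ f) p (0, 1) (1, 0) := by
        change fderiv ℝ (fun q => fderiv ℝ f q (1, 0)) p (0, 1) = _
        rw [e1]; simp
      have e4 : pd1 (pd2 f) p = fderiv ℝ (fderiv ℝ f) p (1, 0) (0, 1) := by
        change fderiv ℝ (fun q => fderiv ℝ f q (0, 1)) p (1, 0) = _
        rw [e2]; simp
      rw [e3, e4, e]
    have h1 : ∀ p : ℝ × ℝ, 0 < p.1 → HG (pd1 f) (pd1 (pd1 f) p) (pd1 (pd2 f) p) p :=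
      fun p hp => (HG.of ((dA hfd p hp).clm_apply (differentiableAt_const _))).congr rfl (hsym p hp)
    obtain ⟨c, hc⟩ := HG.is_const (g := fun q => ε / 2 * (pd1 f q + f q * q.1⁻¹)) (by
      intro p hp
      obtain ⟨E1, E2, E3⟩ := H p hp
      have hp' := hp.ne'
      refine ((HG.const (ε / 2) p).mul ((h1 p hp).add ((h0 p hp).mul (.inv p hp)))).congr ?_ ?_
      · have : pd1 (pd1 f) p = (1 / p.1 ^ 2) * f p + (-1 / p.1) * pd1 f p := by linarith
        rw [this]; field_simp; ring
      · have : pd1 (pd2 f) p = (-1 / p.1) * pd2 f p := by linarith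
        rw [this]; field_simp; ring)
    obtain ⟨b, hb⟩ := HG.is_const (g := fun q => q.1 * pd2 f q - (2 * c) * q.2) (by
      intro p hp
      obtain ⟨E1, E2, E3⟩ := H p hp
      have hp' := hp.ne'
      refine (((HG.fst p).mul (h2 p hp)).sub ((HG.const (2 * c) p).mul (.snd p))).congr ?_ ?_
      · have : pd1 (pd2 f) p = (-1 / p.1) * pd2 f p := by linarith
        rw [this]; field_simp; ring
      · have : pd2 (pd2 f) p = (ε / p.1 ^ 2) * f p + (ε / p.1) * pd1 f p := by linarith
        rw [this, ← hc p hp]; field_simp; ring)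
    obtain ⟨a, ha⟩ := HG.is_const
        (g := fun q => q.1 * f q - b * q.2 - c * (q.2 * q.2 + ε * (q.1 * q.1))) (by
      intro p hp
      have hp' := hp.ne'
      refine ((((HG.fst p).mul (h0 p hp)).sub ((HG.const b p).mul (.snd p))).sub
        ((HG.const c p).mul (((HG.snd p).mul (.snd p)).add
          ((HG.const ε p).mul ((HG.fst p).mul (.fst p)))))).congr ?_ ?_
      · have e : c * ε = (pd1 f p + f p * p.1⁻¹) / 2 := by
          rw [← hc p hp]; linear_combination (pd1 f p + f p * p.1⁻¹) / 2 * he2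
        have e' : f p * p.1⁻¹ * p.1 = f p := by field_simp
        linear_combination (-2 * p.1) * e - e'
      · have := hb p hp
        linear_combination this)
    refine ⟨a, b, c, fun p hp => ?_⟩
    have := ha p hp
    have hp' := hp.ne'
    rw [← this]; field_simp; ring
  · rintro ⟨a, b, c, hf⟩
    have K0 : ∀ p : ℝ × ℝ, 0 < p.1 → HG f
        (-(a + b * p.2 + c * (p.2 * p.2)) * (p.1⁻¹ * p.1⁻¹) + c * ε)
        ((b + 2 * c * p.2) * p.1⁻¹) p := by
      intro p hp
      have hp' := hp.ne'
      refine HG.congr_fun (g := fun q => (a + b * q.2 + c * (q.2 * q.2)) * q.1⁻¹ + (c * ε) * q.1)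
        ?_ hp ?_
      · refine (((((HG.const a p).add ((HG.const b p).mul (.snd p))).add
          ((HG.const c p).mul ((HG.snd p).mul (.snd p)))).mul (.inv p hp)).add
          ((HG.const (c * ε) p).mul (.fst p))).congr ?_ ?_ <;> field_simp <;> ring
      · intro q hq
        have hq' := hq.ne'
        rw [hf q hq]; field_simp; ring
    have K1 : ∀ p : ℝ × ℝ, 0 < p.1 → pd1 (pd1 f) p =
        2 * (a + b * p.2 + c * (p.2 * p.2)) * (p.1⁻¹ * p.1⁻¹ * p.1⁻¹) := by
      intro p hp
      have hp' := hp.ne'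
      refine (HG.congr_fun (HG.congr (d := _) (((((HG.const (-a) p).sub
        ((HG.const b p).mul (.snd p))).sub
          ((HG.const c p).mul ((HG.snd p).mul (.snd p)))).mul ((HG.inv p hp).mul (.inv p hp))).add
          (HG.const (c * ε) p)) ?_ rfl) hp ?_).pd1
      · field_simp; ring
      · intro q hq
        rw [(K0 q hq).pd1]; ring
    have K2 : ∀ p : ℝ × ℝ, 0 < p.1 →
        HG (pd2 f) (-(b + 2 * c * p.2) * (p.1⁻¹ * p.1⁻¹)) (2 * c * p.1⁻¹) p := by
      intro p hp
      have hp' := hp.ne'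
      refine (HG.congr_fun (HG.congr (((HG.const b p).add
        ((HG.const (2 * c) p).mul (.snd p))).mul (HG.inv p hp)) ?_ ?_) hp
          (fun q hq => (K0 q hq).pd2))
      · field_simp; ring
      · field_simp; ring
    refine ⟨?_, ?_⟩
    · have hx : ContDiffOn ℝ (⊤ : ℕ∞) (fun p : ℝ × ℝ => p.1⁻¹) {p : ℝ × ℝ | 0 < p.1} :=
        contDiff_fst.contDiffOn.inv (fun p hp => ne_of_gt hp)
      refine ContDiffOn.congr (f := fun p : ℝ × ℝ =>
        (a + b * p.2 + c * (p.2 ^ 2 + ε * p.1 ^ 2)) * p.1⁻¹) ?_ ?_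
      · refine ContDiffOn.mul (ContDiff.contDiffOn ?_) hx
        fun_prop
      · intro p hp
        rw [hf p hp]; ring
    · intro p hp
      have hp' := hp.ne'
      rw [K1 p hp, (K0 p hp).pd1, (K0 p hp).pd2, (K2 p hp).pd1, (K2 p hp).pd2, hf p hp]
      refine ⟨?_, ?_, ?_⟩
      · field_simp; ring
      · field_simp; ring
      · field_simp
        linear_combination (-2 * c * p.1 ^ 2) * he2
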